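/- For all integers m, n, t > 0 and all rational numbers x, y with x ≠ 0 and x ≠ −1, the following identity holds in ℚ: Σ_{S ∈ S(m,n,t)} x^{codim(S)−ret(S)} · y^{ret(S)} = x^{n−t} · Σ_{P ∈ D(m,n,t)} ((x+1)/x)^{val(P)} · ((y+1)/(x+1))^{ret(P)}, where x^{codim(S)−ret(S)} and x^{n−t} denote integer powers of the nonzero rational x. -/

import Mathlib

/-- A step of a lattice path: north `(0,1)`, east `(1,0)` or diagonal `(1,1)`. -/
inductive Step : Type
  | N : Step
  | E : Step
  | D : Step
  deriving DecidableEq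

/-- The displacement vector of a step. -/
def stepVec : Step → ℤ × ℤ
  | .N => (0, 1)
  | .E => (1, 0)
  | .D => (1, 1)

/-- The lattice point reached after the first `k` steps of the path `P` (starting at the
origin). -/
def pt (P : List Step) (k : ℕ) : ℤ × ℤ := ((P.take k).map stepVec).sum

/-- The path `P` starts with at least `t` north steps. -/
def StartsNorth (t : ℤ) (P : List Step) : Prop := List.replicate t.toNat Step.N <+: P

/-- The path `P` stays weakly above the line `x = m·y`. -/
def AboveLine (m : ℤ) (P : List Step) : Prop := ∀ k : ℕ, (pt P k).1 ≤ m * (pt P k).2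

/-- An `(m,t)`-Schröder path of height `n`: a lattice path from `(0,0)` to `(mn,n)` using
north, east and diagonal steps, starting with at least `t` north steps and never going
below the line `x = m·y`. -/
def IsSchroeder (m n t : ℤ) (P : List Step) : Prop :=
  StartsNorth t P ∧ pt P P.length = (m * n, n) ∧ AboveLine m P

/-- An `(m,t)`-Dyck path of height `n`: an `(m,t)`-Schröder path of height `n` with no
diagonal steps. -/
def IsDyck (m n t : ℤ) (P : List Step) : Prop :=
  IsSchroeder m n t P ∧ ∀ s ∈ P, s ≠ Step.D

/-- A Schröder path is small if none of its diagonal steps starts on the line `x = m·y`. -/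
def IsSmall (m : ℤ) (P : List Step) : Prop :=
  ∀ j : ℕ, P[j]? = some Step.D → (pt P j).1 ≠ m * (pt P j).2

/-- A Schröder path is positive if it touches the line `x = m·y` only at its two
endpoints. -/
def IsPositive (m : ℤ) (P : List Step) : Prop :=
  ∀ k : ℕ, 0 < k → k < P.length → (pt P k).1 ≠ m * (pt P k).2

/-- The set of indices `j` such that the `j`-th step of `P` is east and the `(j+1)`-st is
north; the corresponding valley point is `pt P (j+1)`. -/
def valleys (P : List Step) : Finset ℕ :=
  (Finset.range P.length).filter fun j => P[j]? = some Step.E ∧ P[j + 1]? = some Step.N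

/-- The number of valleys of `P`. -/
def val (P : List Step) : ℕ := (valleys P).card

/-- The number of valleys of `P` whose `x`-coordinate is congruent to `i` modulo `m`. -/
def ival (m i : ℤ) (P : List Step) : ℕ :=
  ((valleys P).filter fun j => (pt P (j + 1)).1 % m = i % m).card

/-- The set of returns of `P`: valleys of the form `(m·i, i)`. -/
def returns (m : ℤ) (P : List Step) : Finset ℕ :=
  (valleys P).filter fun j => (pt P (j + 1)).1 = m * (pt P (j + 1)).2

/-- The number of returns of `P`. -/
def ret (m : ℤ) (P : List Step) : ℕ := (returns m P).card

/-- The set of indices of diagonal steps of `P`. -/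
def diags (P : List Step) : Finset ℕ :=
  (Finset.range P.length).filter fun j => P[j]? = some Step.D

/-- The number of diagonal steps of `P`. -/
def dg (P : List Step) : ℕ := (diags P).card

/-- A Schröder path is `m`-divisible if every diagonal step ends at an `x`-coordinate
divisible by `m`. -/
def MDivisible (m : ℤ) (P : List Step) : Prop :=
  ∀ j ∈ diags P, m ∣ (pt P (j + 1)).1

/-- The number of cornered diagonal steps of `P`: diagonal steps connecting `(i·m − 1, i)`
to `(i·m, i + 1)` for some `i`. -/
def cd (m : ℤ) (P : List Step) : ℕ :=
  ((diags P).filter fun j => (pt P (j + 1)).1 = m * ((pt P (j + 1)).2 - 1)).card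

/-- The generalized binomial coefficient `C(p,q) = p(p−1)⋯(p−q+1)/q!` for integers `p` and
`q ≥ 0`, and `C(p,q) = 0` for `q < 0`. -/
def C (p q : ℤ) : ℤ :=
  if q < 0 then 0
  else if 0 ≤ p then (p.toNat.choose q.toNat : ℤ)
  else (-1) ^ q.toNat * ((q - p - 1).toNat.choose q.toNat : ℤ)

theorem pt_cons_succ (s : Step) (P : List Step) (k : ℕ) :
    pt (s :: P) (k + 1) = stepVec s + pt P k := by
  simp [pt]

theorem pt_zero (P : List Step) : pt P 0 = 0 := by simp [pt]

/-- The change of `m * y - x` along a step. -/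
def rise (m : ℤ) (s : Step) : ℤ := m * (stepVec s).2 - (stepVec s).1

/-- The path `P`, started at a point with `m * y - x = d`, stays weakly above the line. -/
def AboveFrom (m d : ℤ) (P : List Step) : Prop :=
  ∀ k : ℕ, 0 ≤ d + (m * (pt P k).2 - (pt P k).1)

/-- No diagonal step of `P`, started at a point with `m * y - x = d`, starts on the line. -/
def SmallFrom (m d : ℤ) (P : List Step) : Prop :=
  ∀ j : ℕ, P[j]? = some Step.D → d + (m * (pt P j).2 - (pt P j).1) ≠ 0

/-- The number of returns of `P` when started at a point with `m * y - x = d`. -/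
def retFrom (m d : ℤ) (P : List Step) : ℕ :=
  ((valleys P).filter fun j => d + (m * (pt P (j + 1)).2 - (pt P (j + 1)).1) = 0).card

theorem aboveFrom_zero (m : ℤ) (P : List Step) : AboveFrom m 0 P ↔ AboveLine m P := by
  simp [AboveFrom, AboveLine]

theorem smallFrom_zero (m : ℤ) (P : List Step) : SmallFrom m 0 P ↔ IsSmall m P := by
  simp only [SmallFrom, IsSmall, zero_add, ne_eq, sub_eq_zero]
  exact forall₂_congr fun _ _ => not_congr eq_comm

theorem retFrom_zero (m : ℤ) (P : List Step) : retFrom m 0 P = ret m P := by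
  simp only [retFrom, ret, returns, zero_add, sub_eq_zero]
  congr 1
  exact Finset.filter_congr fun _ _ => eq_comm

theorem rise_add (m d : ℤ) (s : Step) (v : ℤ × ℤ) :
    d + (m * (stepVec s + v).2 - (stepVec s + v).1) = d + rise m s + (m * v.2 - v.1) := by
  simp only [rise, Prod.fst_add, Prod.snd_add]
  ring

theorem aboveFrom_nil (m d : ℤ) : AboveFrom m d [] ↔ 0 ≤ d := by
  simp [AboveFrom, pt]

theorem aboveFrom_cons (m d : ℤ) (s : Step) (P : List Step) :
    AboveFrom m d (s :: P) ↔ 0 ≤ d ∧ AboveFrom m (d + rise m s) P := by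
  constructor
  · intro h
    refine ⟨by simpa [pt_zero] using h 0, fun k => ?_⟩
    simpa only [pt_cons_succ, rise_add] using h (k + 1)
  · rintro ⟨h0, h⟩ (_ | k)
    · simpa [pt_zero] using h0
    · simpa only [pt_cons_succ, rise_add] using h k

theorem smallFrom_nil (m d : ℤ) : SmallFrom m d [] := by
  simp [SmallFrom]

theorem smallFrom_cons (m d : ℤ) (s : Step) (P : List Step) :
    SmallFrom m d (s :: P) ↔ (s = Step.D → d ≠ 0) ∧ SmallFrom m (d + rise m s) P := by
  constructor
  · intro h
    refine ⟨fun hs => by simpa [pt_zero] using h 0 (by simp [hs]), fun k hk => ?_⟩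
    simpa only [pt_cons_succ, rise_add] using h (k + 1) (by simpa using hk)
  · rintro ⟨h0, h⟩ (_ | k) hk
    · simpa [pt_zero] using h0 (by simpa using hk)
    · simpa only [pt_cons_succ, rise_add] using h k (by simpa using hk)

theorem val_nil : val [] = 0 := by simp [val, valleys]

theorem val_cons (s : Step) (P : List Step) :
    val (s :: P) = val P + if s = Step.E ∧ P[0]? = some Step.N then 1 else 0 := by
  simp only [val, valleys, Finset.card_filter, List.length_cons, Finset.sum_range_succ']
  simp

theorem dg_nil : dg [] = 0 := by simp [dg, diags]

theorem dg_cons (s : Step) (P : List Step) :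
    dg (s :: P) = dg P + if s = Step.D then 1 else 0 := by
  simp only [dg, diags, Finset.card_filter, List.length_cons, Finset.sum_range_succ']
  simp

theorem retFrom_nil (m d : ℤ) : retFrom m d [] = 0 := by simp [retFrom, valleys]

theorem retFrom_cons (m d : ℤ) (s : Step) (P : List Step) :
    retFrom m d (s :: P) = retFrom m (d + rise m s) P +
      if (s = Step.E ∧ P[0]? = some Step.N) ∧ d + rise m s = 0 then 1 else 0 := by
  simp only [retFrom, valleys, Finset.filter_filter, Finset.card_filter, List.length_cons,
    Finset.sum_range_succ', pt_cons_succ, rise_add]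
  simp [pt_zero]

/-- Replace every diagonal step by an east step followed by a north step. -/
def expand : List Step → List Step
  | [] => []
  | .N :: S => .N :: expand S
  | .E :: S => .E :: expand S
  | .D :: S => .E :: .N :: expand S

theorem expand_ne_D (S : List Step) : ∀ s ∈ expand S, s ≠ Step.D := by
  induction S with
  | nil => simp [expand]
  | cons s S ih => cases s <;> simpa [expand] using ih

theorem sum_expand (S : List Step) :
    ((expand S).map stepVec).sum = (S.map stepVec).sum := by
  induction S with
  | nil => simp [expand]
  | cons s S ih =>
    cases s <;> simp only [expand, List.map_cons, List.sum_cons, ih, ← add_assoc]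
    simp [stepVec]

theorem aboveFrom_expand (m d : ℤ) (S : List Step) :
    AboveFrom m d (expand S) ↔ AboveFrom m d S ∧ SmallFrom m d S := by
  induction S generalizing d with
  | nil => simp [expand, smallFrom_nil]
  | cons s S ih =>
    cases s
    · simp [expand, aboveFrom_cons, smallFrom_cons, ih, and_assoc]
    · simp [expand, aboveFrom_cons, smallFrom_cons, ih, and_assoc]
    · have hE : rise m .E = -1 := by simp [rise, stepVec]
      have hD : d + rise m .D = d + -1 + rise m .N := by simp [rise, stepVec]; ring
      simp only [expand, aboveFrom_cons, smallFrom_cons, ih, hE, hD, forall_const]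
      constructor
      · rintro ⟨h1, h2, h3, h4⟩
        exact ⟨⟨h1, h3⟩, by omega, h4⟩
      · rintro ⟨⟨h1, h3⟩, h2, h4⟩
        exact ⟨h1, by omega, h3, h4⟩

theorem replicate_prefix_expand (k : ℕ) (S : List Step) :
    List.replicate k Step.N <+: expand S ↔ List.replicate k Step.N <+: S := by
  induction S generalizing k with
  | nil => simp [expand]
  | cons s S ih =>
    cases k
    · simp
    · cases s <;> simp [expand, List.replicate_succ, List.cons_prefix_cons, ih]

theorem isDyck_expand (m n t : ℤ) (S : List Step) :
    IsDyck m n t (expand S) ↔ IsSchroeder m n t S ∧ IsSmall m S := by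
  simp only [IsDyck, IsSchroeder, StartsNorth, replicate_prefix_expand, pt, List.take_length,
    sum_expand, ← aboveFrom_zero, ← smallFrom_zero, aboveFrom_expand, and_assoc]
  have := expand_ne_D S
  tauto

theorem expand_head (S : List Step) :
    (expand S)[0]? = some Step.N ↔ S[0]? = some Step.N := by
  rcases S with _ | ⟨_ | _ | _, S⟩ <;> simp [expand]

/-- The paths obtained from `P` by replacing some of its valleys by diagonal steps. -/
def contractions : List Step → Finset (List Step)
  | [] => {[]}
  | .E :: .N :: P =>
      (contractions P).image (fun S => .E :: .N :: S) ∪ (contractions P).image (.D :: ·)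
  | s :: P => (contractions P).image (s :: ·)

theorem mem_contractions (P S : List Step) (hP : ∀ s ∈ P, s ≠ Step.D) :
    S ∈ contractions P ↔ expand S = P := by
  induction P using contractions.induct generalizing S with
  | case1 => rcases S with _ | ⟨_ | _ | _, S⟩ <;> simp [expand, contractions]
  | case2 P ih =>
    have hP' : ∀ s ∈ P, s ≠ Step.D := fun s hs => hP s (by simp [hs])
    simp only [contractions, Finset.mem_union, Finset.mem_image, ih _ hP']
    rcases S with _ | ⟨_ | _ | _, _ | ⟨_ | _ | _, S⟩⟩ <;> simp [expand]
  | case3 s P hne ih =>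
    have hP' : ∀ s ∈ P, s ≠ Step.D := fun s hs => hP s (by simp [hs])
    have hs : s ≠ Step.D := hP s (by simp)
    rw [contractions]
    · simp only [Finset.mem_image, ih _ hP']
      rcases S with _ | ⟨_ | _ | _, S⟩ <;> cases s <;> simp_all [expand]
      intro h
      exact hne _ h.symm
    · exact hne

theorem sum_contractions (m : ℤ) (x y : ℚ) (hx : x ≠ 0) (hx1 : x ≠ -1) (d : ℤ)
    (P : List Step) (hP : ∀ s ∈ P, s ≠ Step.D) :
    ∑ S ∈ contractions P, x⁻¹ ^ dg S * (y / x) ^ retFrom m d S =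
      ((x + 1) / x) ^ val P * ((y + 1) / (x + 1)) ^ retFrom m d P := by
  have hx1' : x + 1 ≠ 0 := fun h => hx1 (by linarith)
  induction P using contractions.induct generalizing d with
  | case1 => simp [contractions, dg_nil, val_nil, retFrom_nil]
  | case2 P ih =>
    have hP' : ∀ s ∈ P, s ≠ Step.D := fun s hs => hP s (by simp [hs])
    have hD : d + rise m .D = d + rise m .E + rise m .N := by simp [rise, stepVec]; ring
    rw [contractions, Finset.sum_union, Finset.sum_image (by simp), Finset.sum_image (by simp)]
    · simp only [dg_cons, retFrom_cons, val_cons, hD]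
      simp only [reduceCtorEq, if_false, if_true, false_and, true_and, List.getElem?_cons_zero,
        add_zero, pow_add, pow_one]
      split_ifs
      · simp only [pow_one, ← mul_assoc, ← Finset.sum_mul, mul_right_comm _ x⁻¹, ih _ hP']
        field_simp
      · simp only [pow_zero, mul_one, mul_right_comm _ x⁻¹, ← Finset.sum_mul, ih _ hP']
        field_simp
    · rw [Finset.disjoint_left]
      simp
  | case3 s P hne ih =>
    have hP' : ∀ s ∈ P, s ≠ Step.D := fun s hs => hP s (by simp [hs])
    have hs : s ≠ Step.D := hP s (by simp)
    have hhead : ∀ S ∈ contractions P, ¬(s = Step.E ∧ S[0]? = some Step.N) := by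
      rintro S hS ⟨rfl, h⟩
      rw [← expand_head, (mem_contractions P S hP').1 hS] at h
      rcases P with _ | ⟨_ | _ | _, P⟩ <;> simp_all
    have hhead' : ¬(s = Step.E ∧ P[0]? = some Step.N) := by
      rintro ⟨rfl, h⟩
      rcases P with _ | ⟨_ | _ | _, P⟩ <;> simp_all
    rw [contractions, Finset.sum_image (by simp), val_cons, retFrom_cons, if_neg hhead',
      if_neg fun h => hhead' h.1, add_zero, add_zero, ← ih _ hP']
    · refine Finset.sum_congr rfl fun S hS => ?_
      rw [dg_cons, retFrom_cons, if_neg hs, if_neg fun h => hhead S hS h.1, add_zero, add_zero]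
    · exact hne

theorem length_le_sum (P : List Step) :
    (P.length : ℤ) ≤ (P.map stepVec).sum.1 + (P.map stepVec).sum.2 := by
  induction P with
  | nil => simp
  | cons s P ih => cases s <;> simp [stepVec] <;> omega

instance : Finite Step :=
  Set.finite_univ_iff.1 <| (Set.toFinite {Step.N, Step.E, Step.D}).subset
    fun s _ => by cases s <;> simp

theorem finite_isSchroeder (m n t : ℤ) : {S : List Step | IsSchroeder m n t S}.Finite := by
  refine (List.finite_length_le Step (m * n + n).toNat).subset fun S hS => ?_
  have h := length_le_sum S
  have h2 := hS.2.1
  rw [pt, List.take_length] at h2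
  rw [h2] at h
  simp only [Set.mem_ofPred_eq]
  omega

/-- the codimension-return generating function of small `(m,t)`-Schröder
paths as a substitution of the valley-return generating function of `(m,t)`-Dyck paths. -/
theorem statement17 (m n t : ℤ) (hm : 0 < m) (hn : 0 < n) (ht : 0 < t)
    (x y : ℚ) (hx : x ≠ 0) (hx1 : x ≠ -1) :
    (∑ᶠ S ∈ {S : List Step | IsSchroeder m n t S ∧ IsSmall m S},
        x ^ (n - t - (dg S : ℤ) - (ret m S : ℤ)) * y ^ (ret m S))
      = x ^ (n - t)
        * ∑ᶠ P ∈ {P : List Step | IsDyck m n t P},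
            ((x + 1) / x) ^ (val P) * ((y + 1) / (x + 1)) ^ (ret m P) := by
  have hS : {S : List Step | IsSchroeder m n t S ∧ IsSmall m S}.Finite :=
    (finite_isSchroeder m n t).subset fun _ h => h.1
  have hD : {P : List Step | IsDyck m n t P}.Finite :=
    (finite_isSchroeder m n t).subset fun _ h => h.1
  rw [finsum_mem_eq_finite_toFinset_sum _ hS, finsum_mem_eq_finite_toFinset_sum _ hD,
    ← Finset.sum_fiberwise_of_maps_to (t := hD.toFinset) (g := expand)
      (fun S h => by simpa [isDyck_expand] using h), Finset.mul_sum]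
  refine Finset.sum_congr rfl fun P hP => ?_
  have hP : IsDyck m n t P := by simpa using hP
  rw [← retFrom_zero, ← sum_contractions m x y hx hx1 0 P hP.2, Finset.mul_sum]
  refine Finset.sum_congr ?_ fun S _ => ?_
  · ext S
    simp only [Finset.mem_filter, Set.Finite.mem_toFinset, Set.mem_ofPred_eq,
      mem_contractions P S hP.2, ← isDyck_expand]
    exact ⟨fun h => h.2, fun h => ⟨h ▸ hP, h⟩⟩
  · rw [retFrom_zero, zpow_sub₀ hx, zpow_sub₀ hx, zpow_natCast, zpow_natCast, div_pow, inv_pow]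
    field_simp
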